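/- Let N, R ∈ ℤ with N ≥ 3 and 2 ≤ R ≤ N − 1. Then a pair (n_s, φ) ∈ ℤ² satisfies n_s + (R−1)·φ = N, n_s ≥ 2, φ ≥ 1, n_s − φ ≥ 1, and the maximum-50%-overlap condition 2·(n_s − φ) ≤ n_s if and only if there exists t ∈ ℤ with (R − N + 1)/R ≤ (t : ℚ) ≤ (R − N + 1)/(R + 1) such that n_s = N + (R−1)·(t−1) and φ = 1 − t. -/

import Mathlib

/-- For integers `N, R` with `N ≥ 3` and `2 ≤ R ≤ N − 1`, a pair
`(n_s, φ) ∈ ℤ²` satisfies `n_s + (R−1)·φ = N`, `n_s ≥ 2`, `φ ≥ 1`, `n_s − φ ≥ 1`,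
and `2·(n_s − φ) ≤ n_s` iff there is `t ∈ ℤ` with
`(R − N + 1)/R ≤ (t : ℚ) ≤ (R − N + 1)/(R + 1)`, `n_s = N + (R−1)·(t−1)`, and
`φ = 1 − t`. -/
theorem rexee_valid_config_max_overlap_iff (N R : ℤ) (hN : 3 ≤ N) (hR₁ : 2 ≤ R)
    (hR₂ : R ≤ N - 1) (ns φ : ℤ) :
    (ns + (R - 1) * φ = N ∧ ns ≥ 2 ∧ φ ≥ 1 ∧ ns - φ ≥ 1 ∧ 2 * (ns - φ) ≤ ns) ↔
      ∃ t : ℤ, ((R : ℚ) - (N : ℚ) + 1) / (R : ℚ) ≤ (t : ℚ) ∧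
        (t : ℚ) ≤ ((R : ℚ) - (N : ℚ) + 1) / ((R : ℚ) + 1) ∧
        ns = N + (R - 1) * (t - 1) ∧ φ = 1 - t := by
  have hR_pos : (0 : ℚ) < R := by exact_mod_cast (by linarith : (0 : ℤ) < R)
  have lower_iff (t : ℤ) :
      ((R : ℚ) - (N : ℚ) + 1) / (R : ℚ) ≤ (t : ℚ) ↔ R - N + 1 ≤ t * R := by
    rw [div_le_iff₀ hR_pos]
    norm_cast
  have upper_iff (t : ℤ) :
      (t : ℚ) ≤ ((R : ℚ) - (N : ℚ) + 1) / ((R : ℚ) + 1) ↔ t * (R + 1) ≤ R - N + 1 := by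
    rw [le_div_iff₀ (by linarith)]
    norm_cast
  simp only [lower_iff, upper_iff]
  constructor
  · rintro ⟨hsum, -, -, hshift, hoverlap⟩
    exact ⟨1 - φ, by linarith, by linarith, by linarith, by ring⟩
  · rintro ⟨t, hlower, hupper, rfl, rfl⟩
    have ht : t ≤ 0 := by
      by_contra! h
      nlinarith
    exact ⟨by ring, by linarith, by linarith, by linarith, by linarith⟩
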